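/- arXiv:1609.02126 — 4 statements merged into one kernel-verified Lean document; each statement's English description precedes it below -/
import Mathlib

section
/- Let 1 ≤ k ≤ n and let a_1, …, a_n be nonnegative real numbers such that 0 < a < 1, where a := (e/k) ∑_{i=1}^n a_i. Then ∑_{ℓ=k}^n ∑_{A ⊆ {1,…,n}, |A| = ℓ} ∏_{i ∈ A} a_i < (1/√(2πk)) · a^k / (1 − a). -/
open Finset

theorem pow_succ_add_mul_pow_le_add_pow {S x : ℝ} (hS : 0 ≤ S) (hx : 0 ≤ x) (m : ℕ) :
    S ^ (m + 1) + (m + 1) * x * S ^ m ≤ (S + x) ^ (m + 1) := by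
  induction m with
  | zero => simp
  | succ m ih =>
    have h : 0 ≤ (m + 1) * x ^ 2 * S ^ m := by positivity
    calc S ^ (m + 1 + 1) + ((m + 1 : ℕ) + 1) * x * S ^ (m + 1)
        ≤ (S ^ (m + 1) + (m + 1) * x * S ^ m) * (S + x) := by
          push_cast
          linear_combination h
      _ ≤ (S + x) ^ (m + 1) * (S + x) := by gcongr
      _ = (S + x) ^ (m + 1 + 1) := (pow_succ _ _).symm

theorem factorial_mul_sum_powersetCard_prod_le_sum_pow {ι : Type*} (s : Finset ι) (f : ι → ℝ)
    (hf : ∀ i ∈ s, 0 ≤ f i) (m : ℕ) :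
    (m.factorial : ℝ) * ∑ A ∈ s.powersetCard m, ∏ i ∈ A, f i ≤ (∑ i ∈ s, f i) ^ m := by
  classical
  induction s using Finset.induction_on generalizing m with
  | empty =>
    cases m with
    | zero => simp
    | succ m => simp [powersetCard_eq_empty.2 (show #(∅ : Finset ι) < m + 1 by simp)]
  | insert x s hx ih =>
    have hfs : ∀ i ∈ s, 0 ≤ f i := fun i hi => hf i (mem_insert_of_mem hi)
    cases m with
    | zero => simp
    | succ m =>
      have hfx : 0 ≤ f x := hf x (mem_insert_self x s)
      have hmem : ∀ A ∈ s.powersetCard m, x ∉ A :=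
        fun A hA hxA => hx ((mem_powersetCard.1 hA).1 hxA)
      have hdisj : Disjoint (s.powersetCard (m + 1)) ((s.powersetCard m).image (insert x)) := by
        refine Finset.disjoint_left.2 fun A hA hA' => ?_
        obtain ⟨B, -, rfl⟩ := mem_image.1 hA'
        exact hx ((mem_powersetCard.1 hA).1 (mem_insert_self x B))
      have hinj : Set.InjOn (insert x) (s.powersetCard m : Set (Finset ι)) := by
        intro A hA B hB hAB
        rw [← erase_insert (hmem A hA), ← erase_insert (hmem B hB), hAB]
      have hsum : ∑ A ∈ s.powersetCard m, ∏ i ∈ insert x A, f i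
          = f x * ∑ A ∈ s.powersetCard m, ∏ i ∈ A, f i := by
        rw [mul_sum]
        exact sum_congr rfl fun A hA => prod_insert (hmem A hA)
      rw [powersetCard_succ_insert hx, sum_union hdisj, sum_image hinj, hsum, sum_insert hx]
      have h₁ := ih hfs (m + 1)
      have h₂ := mul_le_mul_of_nonneg_left (ih hfs m) (by positivity : 0 ≤ (m + 1) * f x)
      have h₃ := pow_succ_add_mul_pow_le_add_pow (sum_nonneg hfs) hfx m
      rw [Nat.factorial_succ] at h₁ ⊢
      push_cast at h₁ ⊢
      rw [add_comm (f x)]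
      linear_combination h₁ + h₂ + h₃

theorem sqrt_mul_pow_le_factorial {k m : ℕ} (hkm : k ≤ m) :
    √(2 * Real.pi * k) * (k / Real.exp 1) ^ m ≤ (m.factorial : ℝ) :=
  calc √(2 * Real.pi * k) * (k / Real.exp 1) ^ m
      ≤ √(2 * Real.pi * m) * (m / Real.exp 1) ^ m := by gcongr
    _ ≤ m.factorial := Stirling.le_factorial_stirling m

theorem sum_Icc_pow_lt {r : ℝ} (h0 : 0 < r) (h1 : r < 1) {k n : ℕ} (hkn : k ≤ n) :
    ∑ m ∈ Finset.Icc k n, r ^ m < r ^ k / (1 - r) := by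
  have hr : 0 < 1 - r := sub_pos.2 h1
  rw [← Finset.Ico_add_one_right_eq_Icc, geom_sum_Ico' h1.ne (by omega)]
  gcongr
  exact sub_lt_self _ (by positivity)

/-- **Corollary of Maclaurin's inequality.**
If `1 ≤ k ≤ n`, `a_1, …, a_n ≥ 0` and `a := (e/k) ∑ a_i ∈ (0,1)`, then
`∑_{ℓ=k}^n ∑_{|A|=ℓ} ∏_{i∈A} a_i < (1/√(2πk)) a^k/(1-a)`. -/
theorem elementary_symmetric_tail_bound (n k : ℕ) (hk1 : 1 ≤ k) (hkn : k ≤ n)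
    (a : ℕ → ℝ) (ha : ∀ i ∈ Finset.Icc 1 n, 0 ≤ a i)
    (hA0 : 0 < Real.exp 1 / k * ∑ i ∈ Finset.Icc 1 n, a i)
    (hA1 : Real.exp 1 / k * ∑ i ∈ Finset.Icc 1 n, a i < 1) :
    ∑ ℓ ∈ Finset.Icc k n, ∑ A ∈ (Finset.Icc 1 n).powersetCard ℓ, ∏ i ∈ A, a i
      < (1 / Real.sqrt (2 * Real.pi * k)) *
        ((Real.exp 1 / k * ∑ i ∈ Finset.Icc 1 n, a i) ^ k /
          (1 - Real.exp 1 / k * ∑ i ∈ Finset.Icc 1 n, a i)) := by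
  set S := ∑ i ∈ Finset.Icc 1 n, a i
  have hk : (0 : ℝ) < k := by exact_mod_cast hk1
  have hsqrt : 0 < √(2 * Real.pi * k) := by positivity
  have hS : 0 ≤ S := Finset.sum_nonneg ha
  have hterm : ∀ m ∈ Finset.Icc k n, ∑ A ∈ (Finset.Icc 1 n).powersetCard m, ∏ i ∈ A, a i
      ≤ 1 / √(2 * Real.pi * k) * (Real.exp 1 / k * S) ^ m := by
    intro m hm
    calc ∑ A ∈ (Finset.Icc 1 n).powersetCard m, ∏ i ∈ A, a i
        ≤ S ^ m / m.factorial := by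
          rw [le_div_iff₀' (by positivity)]
          exact factorial_mul_sum_powersetCard_prod_le_sum_pow _ a ha m
      _ ≤ S ^ m / (√(2 * Real.pi * k) * (k / Real.exp 1) ^ m) := by
          gcongr
          exact sqrt_mul_pow_le_factorial (Finset.mem_Icc.1 hm).1
      _ = 1 / √(2 * Real.pi * k) * (Real.exp 1 / k * S) ^ m := by
          rw [mul_pow, div_pow, div_pow]
          field_simp
  refine (Finset.sum_le_sum hterm).trans_lt ?_
  rw [← Finset.mul_sum]
  exact mul_lt_mul_of_pos_left (sum_Icc_pow_lt hA0 hA1 hkn) (by positivity)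
end

section
/- Let 1 ≤ k ≤ n and let (a_i)_{i=1}^n be a non-increasing sequence of positive real numbers. For each j ≤ n set b_j := ∑_{i=j}^n a_i, and let m ≤ k be the smallest positive integer such that a_m ≤ b_m/(k+1−m). Then there exists a partition (A_j)_{j=1}^k of {1, 2, …, n} into k nonempty pairwise disjoint sets such that A_j = {j} for every j < m, and ∑_{i ∈ A_j} a_i ≥ b_m / (2(k+1−m)) for every j with m ≤ j ≤ k. -/
open Finset

/-- If all weights are at most `T` and the total weight is at least `T / 2`, then some subset has
weight in `[T / 2, T]`. -/
theorem exists_subset_sum_mem_Icc_half {ι : Type*} (f : ι → ℝ) (T : ℝ) (hT : 0 ≤ T)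
    (S : Finset ι) (hf : ∀ i ∈ S, f i ≤ T) (hS : T / 2 ≤ ∑ i ∈ S, f i) :
    ∃ S' ⊆ S, T / 2 ≤ ∑ i ∈ S', f i ∧ ∑ i ∈ S', f i ≤ T := by
  classical
  induction S using Finset.induction_on with
  | empty => exact ⟨∅, subset_rfl, hS, by simpa using hT⟩
  | insert x S hx ih =>
    by_cases h : T / 2 ≤ ∑ i ∈ S, f i
    · obtain ⟨S', hS', h'⟩ := ih (fun i hi => hf i (mem_insert_of_mem hi)) h
      exact ⟨S', hS'.trans (subset_insert x S), h'⟩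
    · by_cases hle : ∑ i ∈ insert x S, f i ≤ T
      · exact ⟨insert x S, subset_rfl, hS, hle⟩
      · rw [sum_insert hx] at hle
        refine ⟨{x}, by simp, ?_, ?_⟩
        · rw [sum_singleton]; linarith
        · simpa using hf x (mem_insert_self x S)

/-- If all weights are at most `T` and the total weight is at least `(q + 1) * T`, then the index
set can be coloured with `q + 1` colours so that every colour class has weight at least `T / 2`. -/
theorem exists_coloring_half_le_sum {ι : Type*} (f : ι → ℝ) (T : ℝ) (hT : 0 ≤ T) (q : ℕ)
    (S : Finset ι) (hf : ∀ i ∈ S, f i ≤ T) (hS : (q + 1) * T ≤ ∑ i ∈ S, f i) :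
    ∃ c : ι → ℕ, (∀ i ∈ S, c i ≤ q) ∧ ∀ j ≤ q, T / 2 ≤ ∑ i ∈ S with c i = j, f i := by
  classical
  induction q generalizing S with
  | zero =>
    refine ⟨fun _ => 0, by simp, fun j hj => ?_⟩
    obtain rfl : j = 0 := by lia
    simp only [filter_true]
    push_cast at hS
    linarith
  | succ q ih =>
    push_cast at hS
    have hqT : 0 ≤ (q : ℝ) * T := by positivity
    obtain ⟨S', hS'S, hlow, hupp⟩ :=
      exists_subset_sum_mem_Icc_half f T hT S hf (by linarith)
    have hsplit := sum_sdiff (f := f) hS'S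
    obtain ⟨c, hc, hcsum⟩ := ih (S \ S') (fun i hi => hf i (mem_sdiff.1 hi).1) (by linarith)
    refine ⟨fun i => if i ∈ S' then q + 1 else c i, fun i hi => ?_, fun j hj => ?_⟩
    · dsimp only
      split_ifs with h
      · exact le_rfl
      · exact (hc i (mem_sdiff.2 ⟨hi, h⟩)).trans q.le_succ
    · rcases hj.eq_or_lt with rfl | hj
      · convert hlow using 2
        ext i
        have := hc i
        have := @hS'S i
        grind
      · convert hcsum j (by lia) using 2
        ext i
        grind

/-- **Partition lemma.**
For a non-increasing positive sequence `a_1 ≥ … ≥ a_n > 0`, `b_j := ∑_{i=j}^n a_i`, and `m ≤ k`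
the smallest index with `a_m ≤ b_m/(k+1−m)`, there is a partition `(A_j)_{j≤k}` of `{1,…,n}`
with `A_j = {j}` for `j < m` and `∑_{i∈A_j} a_i ≥ b_m/(2(k+1−m))` for `m ≤ j ≤ k`. -/
theorem partition_lemma (n k : ℕ) (hk1 : 1 ≤ k) (hkn : k ≤ n)
    (a : ℕ → ℝ) (hpos : ∀ i ∈ Finset.Icc 1 n, 0 < a i)
    (hmono : ∀ i ∈ Finset.Icc 1 n, ∀ j ∈ Finset.Icc 1 n, i ≤ j → a j ≤ a i)
    (m : ℕ) (hm1 : 1 ≤ m) (hmk : m ≤ k)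
    (hm : a m ≤ (∑ i ∈ Finset.Icc m n, a i) / ((k : ℝ) + 1 - m))
    (hmin : ∀ m', 1 ≤ m' → m' < m →
      ¬ (a m' ≤ (∑ i ∈ Finset.Icc m' n, a i) / ((k : ℝ) + 1 - m'))) :
    ∃ A : ℕ → Finset ℕ,
      (∀ j ∈ Finset.Icc 1 k, (A j).Nonempty) ∧
      (∀ j ∈ Finset.Icc 1 k, ∀ j' ∈ Finset.Icc 1 k, j ≠ j' → Disjoint (A j) (A j')) ∧
      ((Finset.Icc 1 k).biUnion A = Finset.Icc 1 n) ∧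
      (∀ j, 1 ≤ j → j < m → A j = {j}) ∧
      (∀ j, m ≤ j → j ≤ k →
        (∑ i ∈ Finset.Icc m n, a i) / (2 * ((k : ℝ) + 1 - m)) ≤ ∑ i ∈ A j, a i) := by
  have hq : (0 : ℝ) < (k : ℝ) + 1 - m := by
    have : (m : ℝ) ≤ k := by exact_mod_cast hmk
    linarith
  set b := ∑ i ∈ Finset.Icc m n, a i with hb
  set T := b / ((k : ℝ) + 1 - m) with hT
  have hTpos : 0 < T := (hpos m (mem_Icc.2 ⟨hm1, hmk.trans hkn⟩)).trans_le hm
  obtain ⟨c, hc, hcsum⟩ := exists_coloring_half_le_sum a T hTpos.le (k - m) (Icc m n)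
    (fun i hi => (hmono m (by grind) i (by grind) (by grind)).trans hm) (by
      rw [Nat.cast_sub hmk, hT, ← hb]
      apply le_of_eq
      field_simp
      ring)
  have hTb : b / (2 * ((k : ℝ) + 1 - m)) = T / 2 := by
    rw [hT, div_div, mul_comm]
  rw [hTb]
  clear hpos hmono hmin hm hTb hT hb hq
  clear_value T b
  let g : ℕ → ℕ := fun i => if i < m then i else m + c i
  let A : ℕ → Finset ℕ := fun j => {i ∈ Icc 1 n | g i = j}
  have hsingle : ∀ j, 1 ≤ j → j < m → A j = {j} := by
    intro j h1 hj
    ext i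
    grind
  have hsum : ∀ j, m ≤ j → j ≤ k → T / 2 ≤ ∑ i ∈ A j, a i := by
    intro j hj hjk
    convert hcsum (j - m) (by lia) using 2
    ext i
    grind
  refine ⟨A, fun j hj => ?_, fun j _ j' _ hne => ?_, ?_, hsingle, hsum⟩
  · rcases lt_or_ge j m with h | h
    · simp [hsingle j (mem_Icc.1 hj).1 h]
    · apply nonempty_of_sum_ne_zero (f := a)
      exact ((half_pos hTpos).trans_le (hsum j h (mem_Icc.1 hj).2)).ne'
  · rw [disjoint_left]
    grind
  · ext i
    have := hc i
    simp only [A, mem_biUnion, mem_filter]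
    exact ⟨fun ⟨_, _, hi, _⟩ => hi, fun hi => ⟨g i, by grind, hi, rfl⟩⟩
end

section
/- Let α > 0, 1 ≤ k ≤ n and 0 < x_1 ≤ … ≤ x_n; for j ≤ n set b_j := ∑_{i=j}^n 1/x_i. Let ξ_1, …, ξ_n be (possibly dependent) random variables each satisfying the α-condition, let F_i be the cumulative distribution function of |x_i ξ_i| for each i ≤ n, let F := (1/n) ∑_{i=1}^n F_i, and let q be any quantile of F of order (k − 1/2)/n, i.e. a number q with F(q⁻) ≤ (k−1/2)/n ≤ F(q). Then q ≥ (1/(2α)) · max_{1 ≤ j ≤ k} (k − j + 1)/b_j. -/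
open MeasureTheory Finset

/-- Rescaling by a positive factor `c` turns the linear small-ball bound with constant `α` into
the bound with constant `α / c`. -/
theorem measureReal_abs_mul_le {Ω : Type*} [MeasurableSpace Ω] (μ : Measure Ω) {α c q : ℝ}
    (hc : 0 < c) (hq : 0 ≤ q) {ξ : Ω → ℝ}
    (h : ∀ t : ℝ, 0 ≤ t → (μ {ω | |ξ ω| ≤ t}).toReal ≤ α * t) :
    (μ {ω | |c * ξ ω| ≤ q}).toReal ≤ α * q * (1 / c) := by
  have hset : {ω | |c * ξ ω| ≤ q} = {ω | |ξ ω| ≤ q / c} := by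
    ext ω
    simp only [Set.mem_ofPred_eq, abs_mul, abs_of_pos hc, le_div_iff₀' hc]
  rw [hset]
  exact (h _ (by positivity)).trans_eq (by ring)

/-- **Lower bound on quantiles of the averaged cdf.**
If each `ξ_i` satisfies the α-condition, `F = (1/n) ∑ F_{|x_i ξ_i|}` and `q` is a quantile of
`F` of order `(k−1/2)/n`, then `q ≥ (1/(2α)) · max_{1≤j≤k} (k−j+1)/b_j`
where `b_j = ∑_{i=j}^n 1/x_i`. -/
theorem quantile_lower_bound (α : ℝ) (hα : 0 < α) (n k : ℕ) (hk1 : 1 ≤ k) (hkn : k ≤ n)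
    (x : ℕ → ℝ) (hx : ∀ i ∈ Finset.Icc 1 n, 0 < x i)
    (hmono : ∀ i ∈ Finset.Icc 1 n, ∀ j ∈ Finset.Icc 1 n, i ≤ j → x i ≤ x j)
    (Ω : Type*) [MeasurableSpace Ω] (μ : Measure Ω) [IsProbabilityMeasure μ]
    (ξ : ℕ → Ω → ℝ) (hmeas : ∀ i, Measurable (ξ i))
    (hacond : ∀ i ∈ Finset.Icc 1 n, ∀ t : ℝ, 0 ≤ t →
      (μ {ω | |ξ i ω| ≤ t}).toReal ≤ α * t)
    (q : ℝ)
    (hq1 : ∀ s < q,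
      (1 / (n : ℝ)) * ∑ i ∈ Finset.Icc 1 n, (μ {ω | |x i * ξ i ω| ≤ s}).toReal
        ≤ ((k : ℝ) - 1 / 2) / n)
    (hq2 : ((k : ℝ) - 1 / 2) / n
        ≤ (1 / (n : ℝ)) * ∑ i ∈ Finset.Icc 1 n, (μ {ω | |x i * ξ i ω| ≤ q}).toReal) :
    (1 / (2 * α)) * (Finset.Icc 1 k).sup' (Finset.nonempty_Icc.mpr hk1)
        (fun j => ((k : ℝ) - j + 1) / ∑ i ∈ Finset.Icc j n, 1 / x i) ≤ q := by
  have hn : (0 : ℝ) < n := by exact_mod_cast hk1.trans hkn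
  have hk : (1 : ℝ) ≤ k := by exact_mod_cast hk1
  have hsum : (k : ℝ) - 1 / 2 ≤
      ∑ i ∈ Finset.Icc 1 n, (μ {ω | |x i * ξ i ω| ≤ q}).toReal := by
    rwa [one_div_mul_eq_div, div_le_div_iff_of_pos_right hn] at hq2
  have hq : 0 ≤ q := by
    by_contra! hneg
    have hzero : ∑ i ∈ Finset.Icc 1 n, (μ {ω | |x i * ξ i ω| ≤ q}).toReal = 0 := by
      refine Finset.sum_eq_zero fun i _ => ?_
      have hempty : {ω | |x i * ξ i ω| ≤ q} = ∅ :=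
        Set.eq_empty_of_forall_notMem fun ω hω => absurd (abs_nonneg _) (hω.trans_lt hneg).not_ge
      rw [hempty, measure_empty, ENNReal.toReal_zero]
    linarith
  rw [one_div_mul_eq_div, div_le_iff₀ (by positivity)]
  refine Finset.sup'_le _ _ fun j hj => ?_
  obtain ⟨hj1, hjk⟩ := Finset.mem_Icc.mp hj
  have hjk' : (j : ℝ) ≤ k := by exact_mod_cast hjk
  have hmem : ∀ i ∈ Finset.Icc j n, i ∈ Finset.Icc 1 n := fun i hi =>
    Finset.Icc_subset_Icc_left hj1 hi
  have hb : 0 < ∑ i ∈ Finset.Icc j n, 1 / x i :=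
    Finset.sum_pos (fun i hi => one_div_pos.mpr (hx i (hmem i hi)))
      (Finset.nonempty_Icc.mpr (hjk.trans hkn))
  have hunion : Finset.Icc 1 n = Finset.Ico 1 j ∪ Finset.Icc j n := by
    ext i
    simp only [Finset.mem_union, Finset.mem_Icc, Finset.mem_Ico]
    omega
  have hdisj : Disjoint (Finset.Ico 1 j) (Finset.Icc j n) :=
    Finset.disjoint_left.mpr fun i hi hi' => by
      simp only [Finset.mem_Icc, Finset.mem_Ico] at hi hi'
      omega
  have hhead : ∑ i ∈ Finset.Ico 1 j, (μ {ω | |x i * ξ i ω| ≤ q}).toReal ≤ (j : ℝ) - 1 :=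
    (Finset.sum_le_card_nsmul _ _ 1 fun i _ => measureReal_le_one).trans_eq (by
      simp [Nat.cast_sub hj1])
  have htail : ∑ i ∈ Finset.Icc j n, (μ {ω | |x i * ξ i ω| ≤ q}).toReal ≤
      α * q * ∑ i ∈ Finset.Icc j n, 1 / x i := by
    rw [Finset.mul_sum]
    exact Finset.sum_le_sum fun i hi =>
      measureReal_abs_mul_le μ (hx i (hmem i hi)) hq (hacond i (hmem i hi))
  rw [hunion, Finset.sum_union hdisj] at hsum
  rw [div_le_iff₀ hb]
  linarith
end

section
/- Let α, β > 0 and let ξ be a random variable satisfying both P(|ξ| ≤ t) ≤ α t and P(|ξ| > t) ≤ e^{−βt} for all t ≥ 0. Then ∫_0^∞ max( P(ξ² ≥ t) − 1/2, 0 ) dt ≥ (β² / (48 α²)) · E[ξ²]. (In particular, E[ξ²] ≤ 2/β² and any median M of ξ² satisfies M ≥ 1/(4α²).) -/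
open MeasureTheory

theorem integral_Ioi_exp_neg_mul_sqrt {b : ℝ} (hb : 0 < b) :
    ∫ t in Set.Ioi (0 : ℝ), Real.exp (-(b * √t)) = 2 / b ^ 2 := by
  have h := integral_exp_neg_mul_rpow (p := 1 / 2) (b := b) (by norm_num) hb
  simp only [← Real.sqrt_eq_rpow, neg_mul] at h
  rw [h, show (1 / (1 / 2) + 1 : ℝ) = (2 : ℕ) + 1 by norm_num, Real.Gamma_nat_eq_factorial,
    show (-1 / (1 / 2) : ℝ) = -((2 : ℕ) : ℝ) by norm_num, Real.rpow_neg hb.le, Real.rpow_natCast]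
  norm_num
  ring

theorem integrableOn_Ioi_exp_neg_mul_sqrt {b : ℝ} (hb : 0 < b) :
    IntegrableOn (fun t : ℝ => Real.exp (-(b * √t))) (Set.Ioi 0) := by
  by_contra h
  have h0 := integral_undef h
  rw [integral_Ioi_exp_neg_mul_sqrt hb] at h0
  have : 0 < 2 / b ^ 2 := by positivity
  exact this.ne' h0

theorem integral_sq_le_of_exp_tail {β : ℝ} (hβ : 0 < β) {Ω : Type*} [MeasurableSpace Ω]
    {μ : Measure Ω} {ξ : Ω → ℝ}
    (hbcond : ∀ t : ℝ, 0 ≤ t → (μ {ω | t < |ξ ω|}).toReal ≤ Real.exp (-(β * t))) :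
    ∫ ω, (ξ ω) ^ 2 ∂μ ≤ 2 / β ^ 2 := by
  by_cases hint : Integrable (fun ω => (ξ ω) ^ 2) μ
  · rw [hint.integral_eq_integral_meas_lt (.of_forall fun ω => sq_nonneg _),
      ← integral_Ioi_exp_neg_mul_sqrt hβ]
    refine integral_mono_of_nonneg (.of_forall fun t => ENNReal.toReal_nonneg)
      (integrableOn_Ioi_exp_neg_mul_sqrt hβ) ?_
    refine (ae_restrict_iff' measurableSet_Ioi).2 (.of_forall fun t ht => ?_)
    have hset : {ω | t < (ξ ω) ^ 2} = {ω | √t < |ξ ω|} := by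
      ext ω
      simp only [Set.mem_ofPred_eq, ← Real.sqrt_sq_eq_abs]
      exact (Real.sqrt_lt_sqrt_iff (le_of_lt ht)).symm
    simpa [Measure.real, hset] using hbcond (√t) (Real.sqrt_nonneg t)
  · rw [integral_undef hint]
    positivity

theorem integral_half_sub_mul_sqrt {α : ℝ} (hα : 0 < α) :
    ∫ t in (0 : ℝ)..1 / (4 * α ^ 2), (1 / 2 - α * √t) = 1 / (24 * α ^ 2) := by
  have hs : √(1 / (4 * α ^ 2)) = 1 / (2 * α) := by
    rw [show 1 / (4 * α ^ 2) = (1 / (2 * α)) ^ 2 by field_simp; norm_num]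
    exact Real.sqrt_sq (by positivity)
  have hpow : (1 / (4 * α ^ 2)) ^ (1 / 2 + 1 : ℝ) = 1 / (8 * α ^ 3) := by
    rw [Real.rpow_add (by positivity), Real.rpow_one, ← Real.sqrt_eq_rpow, hs]
    field_simp
    norm_num
  have hsq : ∫ t in (0 : ℝ)..1 / (4 * α ^ 2), √t = 1 / (12 * α ^ 3) := by
    simp only [Real.sqrt_eq_rpow]
    rw [integral_rpow (Or.inl (by norm_num)), hpow, Real.zero_rpow (by norm_num)]
    field_simp
    norm_num
  rw [intervalIntegral.integral_sub (by simp)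
    ((by fun_prop : Continuous fun t : ℝ => α * √t).intervalIntegrable _ _),
    intervalIntegral.integral_const_mul, hsq, intervalIntegral.integral_const, smul_eq_mul]
  field_simp
  norm_num

/-- **The (α,β)-condition implies the approximation-efficiency condition.**
If `P(|ξ| ≤ t) ≤ αt` and `P(|ξ| > t) ≤ e^{−βt}` for all `t ≥ 0`, then
`∫₀^∞ max(P(ξ² ≥ t) − 1/2, 0) dt ≥ (β²/(48α²)) E ξ²`; moreover `E ξ² ≤ 2/β²` and any
median `M` of `ξ²` satisfies `M ≥ 1/(4α²)`. -/
theorem ab_condition_efficiency (α β : ℝ) (hα : 0 < α) (hβ : 0 < β)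
    (Ω : Type*) [MeasurableSpace Ω] (μ : Measure Ω) [IsProbabilityMeasure μ]
    (ξ : Ω → ℝ) (hmeas : Measurable ξ)
    (hacond : ∀ t : ℝ, 0 ≤ t → (μ {ω | |ξ ω| ≤ t}).toReal ≤ α * t)
    (hbcond : ∀ t : ℝ, 0 ≤ t → (μ {ω | t < |ξ ω|}).toReal ≤ Real.exp (-(β * t))) :
    (β ^ 2 / (48 * α ^ 2)) * (∫ ω, (ξ ω) ^ 2 ∂μ)
        ≤ ∫ t in Set.Ioi (0 : ℝ), max ((μ {ω | t ≤ (ξ ω) ^ 2}).toReal - 1 / 2) 0 ∧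
    (∫ ω, (ξ ω) ^ 2 ∂μ) ≤ 2 / β ^ 2 ∧
    ∀ M : ℝ, 1 / 2 ≤ (μ {ω | M ≤ (ξ ω) ^ 2}).toReal →
      1 / 2 ≤ (μ {ω | (ξ ω) ^ 2 ≤ M}).toReal → 1 / (4 * α ^ 2) ≤ M := by
  have hsecond := integral_sq_le_of_exp_tail hβ hbcond
  have hsmall (t : ℝ) (ht : 0 ≤ t) : (μ {ω | (ξ ω) ^ 2 ≤ t}).toReal ≤ α * √t := by
    refine le_trans (measureReal_mono (μ := μ) fun ω hω => ?_) (hacond _ (Real.sqrt_nonneg t))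
    exact Real.abs_le_sqrt hω
  refine ⟨?_, hsecond, fun M _ hM => ?_⟩
  · set F : ℝ → ℝ := fun t => max ((μ {ω | t ≤ (ξ ω) ^ 2}).toReal - 1 / 2) 0
    have hlower (t : ℝ) (ht : 0 ≤ t) : 1 / 2 - α * √t ≤ F t := by
      refine le_trans ?_ (le_max_left _ _)
      have hunion : (1 : ℝ) ≤ (μ {ω | t ≤ (ξ ω) ^ 2}).toReal + (μ {ω | (ξ ω) ^ 2 ≤ t}).toReal := by
        have h := measureReal_union_le (μ := μ) {ω | t ≤ (ξ ω) ^ 2} {ω | (ξ ω) ^ 2 ≤ t}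
        have hu : {ω | t ≤ (ξ ω) ^ 2} ∪ {ω | (ξ ω) ^ 2 ≤ t} = Set.univ :=
          Set.eq_univ_of_forall fun ω => le_total t ((ξ ω) ^ 2)
        rwa [hu, probReal_univ] at h
      linarith [hsmall t ht]
    have hupper (t : ℝ) (ht : 0 < t) : F t ≤ Real.exp (-(β / 2 * √t)) := by
      have hle : (μ {ω | t ≤ (ξ ω) ^ 2}).toReal ≤ Real.exp (-(β * (√t / 2))) := by
        refine le_trans (measureReal_mono (μ := μ) fun ω hω => ?_) (hbcond _ (by positivity))
        have := Real.sqrt_pos.2 ht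
        have h1 := Real.le_sqrt_of_sq_le (x := √t) (y := (ξ ω) ^ 2)
          (by rw [Real.sq_sqrt ht.le]; exact hω)
        rw [Real.sqrt_sq_eq_abs] at h1
        exact lt_of_lt_of_le (by linarith) h1
      rw [show β / 2 * √t = β * (√t / 2) by ring]
      exact max_le (by linarith) (Real.exp_nonneg _)
    have hanti : Antitone F := fun s t hst =>
      max_le_max_right _ (sub_le_sub_right
        (measureReal_mono (μ := μ) fun ω hω => le_trans hst hω) _)
    have hF : IntegrableOn F (Set.Ioi 0) := by
      refine (integrableOn_Ioi_exp_neg_mul_sqrt (half_pos hβ)).mono'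
        hanti.measurable.aestronglyMeasurable ?_
      refine (ae_restrict_iff' measurableSet_Ioi).2 (.of_forall fun t ht => ?_)
      rw [Real.norm_of_nonneg (le_max_right _ _)]
      exact hupper t ht
    have hT : (0 : ℝ) ≤ 1 / (4 * α ^ 2) := by positivity
    calc β ^ 2 / (48 * α ^ 2) * ∫ ω, (ξ ω) ^ 2 ∂μ
        ≤ β ^ 2 / (48 * α ^ 2) * (2 / β ^ 2) := by gcongr
      _ = 1 / (24 * α ^ 2) := by field_simp; norm_num
      _ = ∫ t in Set.Ioc (0 : ℝ) (1 / (4 * α ^ 2)), (1 / 2 - α * √t) := by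
        rw [← integral_half_sub_mul_sqrt hα, intervalIntegral.integral_of_le hT]
      _ ≤ ∫ t in Set.Ioc (0 : ℝ) (1 / (4 * α ^ 2)), F t := by
        refine setIntegral_mono_on ?_ (hF.mono_set Set.Ioc_subset_Ioi_self) measurableSet_Ioc
          fun t ht => hlower t ht.1.le
        exact (by fun_prop : Continuous fun t : ℝ => 1 / 2 - α * √t).integrableOn_Ioc
      _ ≤ ∫ t in Set.Ioi (0 : ℝ), F t :=
        setIntegral_mono_set hF (.of_forall fun t => le_max_right _ _)
          Set.Ioc_subset_Ioi_self.eventuallyLE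
  · rcases lt_or_ge M 0 with h0 | h0
    · have hempty : {ω | (ξ ω) ^ 2 ≤ M} = ∅ :=
        Set.eq_empty_of_forall_notMem fun ω hω => by
          have : (ξ ω) ^ 2 ≤ M := hω
          linarith [sq_nonneg (ξ ω)]
      rw [hempty] at hM
      norm_num at hM
    · have h := hM.trans (hsmall M h0)
      rw [div_le_iff₀ (by positivity)]
      nlinarith [Real.sq_sqrt h0, mul_self_le_mul_self (by norm_num) h]
end
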